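/- There exist constants c > 0 and n₀ ∈ ℕ such that for all n ≥ n₀, all reals ε with 2^{−(2α−1)n/2} ≤ ε ≤ 1/6, every set M ⊆ [n] with |M| = t, every set A ⊆ [n]∖M with |A| ≥ δn + 2δ√n·log₂ n, and every set V ⊆ M ∪ A with |V| = ⌈9√n⌉, the following holds: if f is the random Boolean function obtained by sampling, independently for each i ∈ [N], a set S_i ⊆ A (including each element of A independently with probability ε/√n) and a uniformly random function h_i depending only on the coordinates in S_i (i.e., h_i(x) = z_i(x|_{S_i}) for independent uniform bits z_i(b), b ∈ {0,1}^{S_i}), and setting f(x) = h_{Γ_M(x)}(x), then Pr[E_V(f) ≥ ε·2^n] ≥ 1 − exp(−2^{cn}). -/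

import Mathlib

open Finset

/-- `f : {0,1}^n → {0,1}` is a `k`-junta: there is a set `S ⊆ [n]` with `|S| ≤ k`
such that `f x = f y` whenever `x` and `y` agree on all coordinates in `S`. -/
def IsJunta (n k : ℕ) (f : (Fin n → Bool) → Bool) : Prop :=
  ∃ S : Finset (Fin n), S.card ≤ k ∧
    ∀ x y : Fin n → Bool, (∀ i ∈ S, x i = y i) → f x = f y

/-- `f` is `ε`-far from every `k`-junta. -/
def FarFromJuntas (n k : ℕ) (ε : ℝ) (f : (Fin n → Bool) → Bool) : Prop :=
  ∀ g : (Fin n → Bool) → Bool, IsJunta n k g →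
    ε * 2 ^ n ≤ ((Finset.univ.filter (fun x => f x ≠ g x)).card : ℝ)

/-- Probability of obtaining exactly the subset `A` when each element of `U` is included
independently with probability `ρ` (and elements outside `U` are never included). -/
noncomputable def pSet {ι : Type*} [DecidableEq ι] (U : Finset ι) (ρ : ℝ) (A : Finset ι) : ℝ :=
  if A ⊆ U then ρ ^ A.card * (1 - ρ) ^ (U.card - A.card) else 0

/-- Zero out the coordinates outside `M`.  Two strings have the same `padTo M` iff they
agree on all coordinates of `M`, so `padTo M x` serves as the index `Γ_M(x)`:
it identifies the restriction `x|_M`. -/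
def padTo {n : ℕ} (M : Finset (Fin n)) (x : Fin n → Bool) : Fin n → Bool :=
  fun j => if j ∈ M then x j else false

/-- The function `f = f_{M,S,H}` built from the addressing set `M`, the family of subsets
`S_i ⊆ A` and the family of random functions `h_i(x) = z_i(x|_{S_i})`: on input `x`, the
index `i = Γ_M(x)` (represented by `padTo M x`) selects `S_i` and `z_i`, and the value is
`z_i` evaluated at the restriction of `x` to `S_i` (represented by `padTo (S i) x`). -/
def buildF {n : ℕ} (M : Finset (Fin n)) (S : (Fin n → Bool) → Finset (Fin n))
    (z : (Fin n → Bool) → (Fin n → Bool) → Bool) : (Fin n → Bool) → Bool :=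
  fun x => z (padTo M x) (padTo (S (padTo M x)) x)

open Classical in
/-- The probability, for fixed `M` and `A`, that the random function `f` obtained by
sampling each `S_i ⊆ A` (elements included independently with probability `ρ`) and
each `h_i` a uniformly random function of the coordinates in `S_i`, satisfies `E f`. -/
noncomputable def prSH (n : ℕ) (M A : Finset (Fin n)) (ρ : ℝ)
    (E : ((Fin n → Bool) → Bool) → Prop) : ℝ :=
  ∑ S : (Fin n → Bool) → Finset (Fin n),
    ∑ z : (Fin n → Bool) → (Fin n → Bool) → Bool,
      (if E (buildF M S z) then 1 else 0) * (∏ y : Fin n → Bool, pSet A ρ (S y)) /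
        (Fintype.card ((Fin n → Bool) → (Fin n → Bool) → Bool) : ℝ)

/-- The probability that a random function `f` drawn from the distribution `D` (with
`M` a uniformly random subset of `[n]` of size `t`, `A ⊆ [n]∖M` with each element
included independently with probability `ρA`, each `S_i ⊆ A` with rate `ρS`, and each
`h_i` a uniformly random function of the coordinates in `S_i`) satisfies `E f`.
Taking `ρA = 1/2` gives `D_yes`; taking `ρA = 1/2 + (log₂ n)/√n` gives `D_no`. -/
noncomputable def prD (n t : ℕ) (ρA ρS : ℝ)
    (E : ((Fin n → Bool) → Bool) → Prop) : ℝ :=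
  (∑ M ∈ Finset.univ.filter (fun M : Finset (Fin n) => M.card = t),
    ∑ A : Finset (Fin n), pSet Mᶜ ρA A * prSH n M A ρS E) / (n.choose t : ℝ)

/-- Flip the `ℓ`-th coordinate of `x`; the pair `(x, flipAt x ℓ)` is the edge of the
hypercube along direction `ℓ` with endpoint `x`. -/
def flipAt {n : ℕ} (x : Fin n → Bool) (ℓ : Fin n) : Fin n → Bool :=
  Function.update x ℓ (!x ℓ)

/-- `C` is a collection of pairwise vertex-disjoint `f`-bichromatic edges along
directions in `V`: each element `(x, ℓ)` of `C` represents the edge `(x, x^(ℓ))`. -/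
def DisjointBichromatic {n : ℕ} (f : (Fin n → Bool) → Bool) (V : Finset (Fin n))
    (C : Finset ((Fin n → Bool) × Fin n)) : Prop :=
  (∀ e ∈ C, e.2 ∈ V ∧ f e.1 ≠ f (flipAt e.1 e.2)) ∧
  ∀ e ∈ C, ∀ e' ∈ C, e ≠ e' →
    e.1 ≠ e'.1 ∧ e.1 ≠ flipAt e'.1 e'.2 ∧
    flipAt e.1 e.2 ≠ e'.1 ∧ flipAt e.1 e.2 ≠ flipAt e'.1 e'.2


/-- Chernoff lower tail for conditionally independent `[0,1]` variables, Laplace form. -/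
lemma laplace_bound {I Ω : Type*} [Fintype I] [DecidableEq I] [Fintype Ω] [Nonempty Ω]
    (w : Ω → ℝ) (hw0 : ∀ v, 0 ≤ w v) (hw1 : ∑ v, w v = 1) (P : Finset I)
    (g : I → (I → Ω) → Ω → ℝ)
    (hg0 : ∀ i ω v, 0 ≤ g i ω v)
    (hinv : ∀ i ∈ P, ∀ ω ω' : I → Ω, (∀ j, j ∉ P → ω j = ω' j) → ∀ v, g i ω v = g i ω' v)
    (b : ℝ) (hb : ∀ i ∈ P, ∀ ω, ∑ v, w v * g i ω v ≤ b) :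
    ∑ ω : I → Ω, (∏ i, w (ω i)) * ∏ i ∈ P, g i ω (ω i) ≤ b ^ P.card := by
  classical
  rw [← (Equiv.piEquivPiSubtypeProd (fun i => i ∈ P) (fun _ => Ω)).symm.sum_comp]
  rw [Fintype.sum_prod_type, Finset.sum_comm]
  have v0 : Ω := Classical.arbitrary Ω
  have key : ∀ (v : {i // i ∉ P} → Ω),
      ∑ u : {i // i ∈ P} → Ω,
        (∏ i, w ((Equiv.piEquivPiSubtypeProd (fun i => i ∈ P) (fun _ => Ω)).symm (u, v) i)) *
          ∏ i ∈ P, g i ((Equiv.piEquivPiSubtypeProd (fun i => i ∈ P) (fun _ => Ω)).symm (u, v))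
            ((Equiv.piEquivPiSubtypeProd (fun i => i ∈ P) (fun _ => Ω)).symm (u, v) i)
        ≤ (∏ i, w (v i)) * b ^ P.card := by
    intro v
    set ω0 : I → Ω := (Equiv.piEquivPiSubtypeProd (fun i => i ∈ P) (fun _ => Ω)).symm
      (fun _ => v0, v) with hω0
    have e1 : ∀ u : {i // i ∈ P} → Ω,
        (∏ i, w ((Equiv.piEquivPiSubtypeProd (fun i => i ∈ P) (fun _ => Ω)).symm (u, v) i)) *
          ∏ i ∈ P, g i ((Equiv.piEquivPiSubtypeProd (fun i => i ∈ P) (fun _ => Ω)).symm (u, v))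
            ((Equiv.piEquivPiSubtypeProd (fun i => i ∈ P) (fun _ => Ω)).symm (u, v) i)
        = (∏ i, w (v i)) * ∏ i : {i // i ∈ P}, (w (u i) * g i ω0 (u i)) := by
      intro u
      rw [← Fintype.prod_subtype_mul_prod_subtype (fun i => i ∈ P)
        (fun i => w ((Equiv.piEquivPiSubtypeProd (fun i => i ∈ P) (fun _ => Ω)).symm (u, v) i))]
      rw [← Finset.prod_coe_sort P, Finset.prod_mul_distrib]
      have a1 : ∀ i : {i // i ∈ P},
          (Equiv.piEquivPiSubtypeProd (fun i => i ∈ P) (fun _ => Ω)).symm (u, v) i = u i := by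
        intro i; simp [Equiv.piEquivPiSubtypeProd]
      have a2 : ∀ i : {i // i ∉ P},
          (Equiv.piEquivPiSubtypeProd (fun i => i ∈ P) (fun _ => Ω)).symm (u, v) i = v i := by
        intro i
        simp [Equiv.piEquivPiSubtypeProd, i.2]
      have a3 : ∀ i : {i // i ∈ P}, ∀ x,
          g i ((Equiv.piEquivPiSubtypeProd (fun i => i ∈ P) (fun _ => Ω)).symm (u, v)) x
            = g i ω0 x := by
        intro i x
        apply hinv _ i.2
        intro j hj
        simp [hω0, Equiv.piEquivPiSubtypeProd, hj]
      simp only [a1, a2, a3]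
      have r : ∀ p p' q s : ℝ, p = p' → p * q * s = q * (p' * s) := by
        rintro p p' q s rfl; ring
      exact r _ _ _ _ (by congr!)
    simp only [e1]
    rw [← Finset.mul_sum]
    apply mul_le_mul_of_nonneg_left _ (Finset.prod_nonneg fun i _ => hw0 _)
    have e2 := Finset.prod_univ_sum (fun _ : {i // i ∈ P} => (Finset.univ : Finset Ω))
      (fun i a => w a * g i ω0 a)
    rw [Fintype.piFinset_univ] at e2
    rw [← e2]
    calc ∏ i : {i // i ∈ P}, ∑ a, w a * g i ω0 a ≤ ∏ i : {i // i ∈ P}, b := by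
          apply Finset.prod_le_prod
          · intro i _
            exact Finset.sum_nonneg fun a _ => mul_nonneg (hw0 _) (hg0 _ _ _)
          · intro i _; exact hb _ i.2 _
      _ = b ^ P.card := by simp
  refine (Finset.sum_le_sum fun v _ => key v).trans ?_
  rw [← Finset.sum_mul]
  have e2 := Finset.prod_univ_sum (fun _ : {i // i ∉ P} => (Finset.univ : Finset Ω))
      (fun _ a => w a)
  rw [Fintype.piFinset_univ] at e2
  rw [← e2]
  simp [hw1]

open Classical in
lemma chernoff_lower {I Ω : Type*} [Fintype I] [DecidableEq I] [Fintype Ω] [Nonempty Ω]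
    (w : Ω → ℝ) (hw0 : ∀ v, 0 ≤ w v) (hw1 : ∑ v, w v = 1) (P : Finset I)
    (X : I → (I → Ω) → Ω → ℝ)
    (hX0 : ∀ i ω v, 0 ≤ X i ω v) (hX1 : ∀ i ∈ P, ∀ ω v, X i ω v ≤ 1)
    (hinv : ∀ i ∈ P, ∀ ω ω' : I → Ω, (∀ j, j ∉ P → ω j = ω' j) → ∀ v, X i ω v = X i ω' v)
    (μ : ℝ) (hμ : ∀ i ∈ P, ∀ ω, μ ≤ ∑ v, w v * X i ω v)
    (l a : ℝ) (hl0 : 0 ≤ l) (hl1 : l ≤ 1) :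
    ∑ ω : I → Ω, (if ∑ i ∈ P, X i ω (ω i) < a then 1 else 0) * (∏ i, w (ω i))
      ≤ Real.exp (l * a - (l - l ^ 2 / 2) * μ * P.card) := by
  have hexp : Real.exp (-l) ≤ 1 - (l - l ^ 2 / 2) := by
    have h1 : 1 + l + l ^ 2 / 2 ≤ Real.exp l := Real.quadratic_le_exp_of_nonneg hl0
    have h2 : Real.exp (-l) * Real.exp l = 1 := by rw [← Real.exp_add]; simp
    have h3 : 0 < Real.exp (-l) := Real.exp_pos _
    have h4 : Real.exp (-l) * (1 + l + l ^ 2 / 2) ≤ 1 := by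
      have := mul_le_mul_of_nonneg_left h1 h3.le
      linarith
    have h5 : (0:ℝ) < 1 + l + l ^ 2 / 2 := by positivity
    have h6 : 1 ≤ (1 - (l - l ^ 2 / 2)) * (1 + l + l ^ 2 / 2) := by
      nlinarith [sq_nonneg (l^2)]
    exact le_of_mul_le_mul_right (h4.trans h6) h5
  have hconv : ∀ x : ℝ, 0 ≤ x → x ≤ 1 → Real.exp (-(l * x)) ≤ 1 - (l - l ^ 2 / 2) * x := by
    intro x h0 h1
    have h := convexOn_exp.2 (Set.mem_univ (0:ℝ)) (Set.mem_univ (-l))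
      (sub_nonneg.2 h1) h0 (by ring)
    simp only [smul_eq_mul, mul_zero, zero_add, Real.exp_zero, mul_one] at h
    have e : x * -l = -(l * x) := by ring
    rw [e] at h
    nlinarith
  have hlap := laplace_bound w hw0 hw1 P
    (fun i ω v => Real.exp (-(l * X i ω v))) (fun _ _ _ => (Real.exp_pos _).le)
    (fun i hi ω ω' h v => by simp only [hinv i hi ω ω' h v])
    (Real.exp (-((l - l ^ 2 / 2) * μ))) (by
      intro i hi ω
      calc ∑ v, w v * Real.exp (-(l * X i ω v))
          ≤ ∑ v, (w v - (l - l ^ 2 / 2) * (w v * X i ω v)) := by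
            apply Finset.sum_le_sum
            intro v _
            nlinarith [mul_le_mul_of_nonneg_left (hconv _ (hX0 i ω v) (hX1 i hi ω v)) (hw0 v)]
        _ = 1 - (l - l ^ 2 / 2) * ∑ v, w v * X i ω v := by
            rw [Finset.sum_sub_distrib, hw1, Finset.mul_sum]
        _ ≤ 1 - (l - l ^ 2 / 2) * μ := by
            have := mul_le_mul_of_nonneg_left (hμ i hi ω)
              (show 0 ≤ l - l ^ 2 / 2 by nlinarith)
            linarith
        _ ≤ _ := by
            have := Real.add_one_le_exp (-((l - l ^ 2 / 2) * μ))
            linarith)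
  have hpt : ∀ ω : I → Ω, (if ∑ i ∈ P, X i ω (ω i) < a then 1 else 0) * (∏ i, w (ω i))
      ≤ Real.exp (l * a) * ((∏ i, w (ω i)) * ∏ i ∈ P, Real.exp (-(l * X i ω (ω i)))) := by
    intro ω
    have hp : 0 ≤ ∏ i, w (ω i) := Finset.prod_nonneg fun i _ => hw0 _
    rw [← Real.exp_sum, mul_left_comm, mul_comm, ← Real.exp_add]
    apply mul_le_mul_of_nonneg_left _ hp
    split_ifs with h
    · apply Real.one_le_exp
      rw [Finset.sum_neg_distrib, ← Finset.mul_sum]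
      nlinarith
    · exact (Real.exp_pos _).le
  refine (Finset.sum_le_sum fun ω _ => hpt ω).trans ?_
  rw [← Finset.mul_sum]
  refine (mul_le_mul_of_nonneg_left hlap (Real.exp_pos _).le).trans ?_
  rw [← Real.exp_nat_mul, ← Real.exp_add]
  apply le_of_eq
  congr 1
  ring

open Classical in
lemma prSH_eq (n : ℕ) (M A : Finset (Fin n)) (ρ : ℝ)
    (E : ((Fin n → Bool) → Bool) → Prop) :
    prSH n M A ρ E = ∑ ω : (Fin n → Bool) → Finset (Fin n) × ((Fin n → Bool) → Bool),
      (if E (buildF M (fun y => (ω y).1) (fun y => (ω y).2)) then 1 else 0) *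
        ∏ y, (pSet A ρ (ω y).1 / (Fintype.card ((Fin n → Bool) → Bool) : ℝ)) := by
  rw [← (Equiv.arrowProdEquivProdArrow _ _ _).symm.sum_comp, Fintype.sum_prod_type]
  unfold prSH
  refine Finset.sum_congr rfl fun S _ => Finset.sum_congr rfl fun z _ => ?_
  rw [mul_div_assoc, Finset.prod_div_distrib]
  simp only [Equiv.arrowProdEquivProdArrow, Equiv.coe_fn_symm_mk]
  congr 2
  rw [Fintype.card_fun (α := Fin n → Bool) (β := (Fin n → Bool) → Bool)]
  simp

lemma sum_pSet {ι : Type*} [Fintype ι] [DecidableEq ι] (U : Finset ι) (ρ : ℝ) :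
    ∑ S, pSet U ρ S = 1 := by
  unfold pSet
  rw [← Finset.sum_filter]
  have : (Finset.univ.filter fun S : Finset ι => S ⊆ U) = U.powerset := by ext; simp
  rw [this, Finset.sum_pow_mul_eq_add_pow]
  simp

lemma pSet_nonneg {ι : Type*} [DecidableEq ι] (U : Finset ι) (ρ : ℝ) (h0 : 0 ≤ ρ) (h1 : ρ ≤ 1)
    (S : Finset ι) : 0 ≤ pSet U ρ S := by
  unfold pSet
  have := sub_nonneg.2 h1
  split_ifs <;> positivity

lemma sum_pSet_disj {ι : Type*} [Fintype ι] [DecidableEq ι] (U V : Finset ι) (hV : V ⊆ U) (ρ : ℝ) :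
    ∑ S, (if (S ∩ V).Nonempty then pSet U ρ S else 0) = 1 - (1 - ρ) ^ V.card := by
  have h : ∀ S, (if (S ∩ V).Nonempty then pSet U ρ S else 0)
      = pSet U ρ S - (1 - ρ) ^ V.card * pSet (U \ V) ρ S := by
    intro S
    have hd : S ⊆ U \ V ↔ S ⊆ U ∧ ¬ (S ∩ V).Nonempty := by
      rw [Finset.subset_sdiff, Finset.not_nonempty_iff_eq_empty, Finset.disjoint_iff_inter_eq_empty]
    unfold pSet
    by_cases h1 : (S ∩ V).Nonempty
    · simp [h1, hd]
    · by_cases h2 : S ⊆ U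
      · have h3 : S ⊆ U \ V := hd.2 ⟨h2, h1⟩
        have h4 := Finset.card_le_card h3
        have h5 := Finset.card_sdiff_add_card_eq_card hV
        have h6 : U.card - S.card = V.card + ((U \ V).card - S.card) := by omega
        rw [if_neg h1, if_pos h2, if_pos h3, h6, pow_add]
        ring
      · simp [h1, h2, hd]
  simp only [h]
  rw [Finset.sum_sub_distrib, ← Finset.mul_sum, sum_pSet, sum_pSet, mul_one]

lemma card_block {n : ℕ} (M : Finset (Fin n)) (y : Fin n → Bool) (hy : padTo M y = y) :
    (Finset.univ.filter fun x => padTo M x = y).card = 2 ^ (n - M.card) := by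
  have : (Finset.univ.filter fun x => padTo M x = y) =
      Fintype.piFinset (fun i => if i ∈ M then {y i} else Finset.univ) := by
    ext x
    simp only [Finset.mem_filter, Finset.mem_univ, true_and, Fintype.mem_piFinset]
    constructor
    · intro h i
      by_cases hi : i ∈ M
      · have := congrFun h i
        simp [padTo, hi] at this ⊢
        exact this
      · simp [hi]
    · intro h
      ext i
      have h' := h i
      rw [← hy]
      by_cases hi : i ∈ M
      · simp [hi] at h'
        simp [padTo, hi, h']
      · simp [padTo, hi]
  rw [this, Fintype.card_piFinset]
  have h2 : ∀ i, (if i ∈ M then ({y i} : Finset Bool) else Finset.univ).card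
      = if i ∈ M then 1 else 2 := by
    intro i; split_ifs <;> simp
  simp only [h2]
  rw [Finset.prod_ite]
  simp
  have : (Finset.univ.filter fun x => x ∉ M) = Mᶜ := by ext; simp
  rw [this, Finset.card_compl, Fintype.card_fin]

lemma card_half {B : Type*} [Fintype B] [DecidableEq B] (b : B) (c : (B → Bool) → Bool)
    (hc : ∀ z v, c (Function.update z b v) = c z) :
    2 * (Finset.univ.filter fun z : B → Bool => z b ≠ c z).card = Fintype.card (B → Bool) := by
  have h1 : (Finset.univ.filter fun z : B → Bool => z b ≠ c z).card
      = (Finset.univ.filter fun z : B → Bool => ¬ (z b ≠ c z)).card := by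
    refine Finset.card_bij' (fun z _ => Function.update z b (!z b))
      (fun z _ => Function.update z b (!z b)) ?_ ?_ ?_ ?_
    · intro z hz
      simp only [Finset.mem_filter, Finset.mem_univ, true_and, hc, Function.update_self] at hz ⊢
      cases h : z b <;> cases h' : c z <;> simp_all
    · intro z hz
      simp only [Finset.mem_filter, Finset.mem_univ, true_and, hc, Function.update_self] at hz ⊢
      cases h : z b <;> cases h' : c z <;> simp_all
    · intro z _; simp
    · intro z _; simp
  have := Finset.card_filter_add_card_filter_not (s := (Finset.univ : Finset (B → Bool)))
    (fun z : B → Bool => z b ≠ c z)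
  rw [Finset.card_univ] at this
  omega

lemma prSH_ge (n : ℕ) (M A : Finset (Fin n)) (ρ : ℝ) (h0 : 0 ≤ ρ) (h1 : ρ ≤ 1)
    (E : ((Fin n → Bool) → Bool) → Prop) (P : Finset (Fin n → Bool))
    (X : (Fin n → Bool) → ((Fin n → Bool) → Finset (Fin n) × ((Fin n → Bool) → Bool)) →
      Finset (Fin n) × ((Fin n → Bool) → Bool) → ℝ)
    (hX0 : ∀ i ω v, 0 ≤ X i ω v) (hX1 : ∀ i ∈ P, ∀ ω v, X i ω v ≤ 1)
    (hinv : ∀ i ∈ P, ∀ ω ω', (∀ j, j ∉ P → ω j = ω' j) → ∀ v, X i ω v = X i ω' v)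
    (μ : ℝ) (hμ : ∀ i ∈ P, ∀ ω, μ ≤ ∑ S, pSet A ρ S *
      ((∑ z, X i ω (S, z)) / (Fintype.card ((Fin n → Bool) → Bool) : ℝ)))
    (l a : ℝ) (hl0 : 0 ≤ l) (hl1 : l ≤ 1)
    (hE : ∀ ω, a ≤ ∑ y ∈ P, X y ω (ω y) →
      E (buildF M (fun y => (ω y).1) (fun y => (ω y).2))) :
    1 - Real.exp (l * a - (l - l ^ 2 / 2) * μ * P.card) ≤ prSH n M A ρ E := by
  classical
  set w : Finset (Fin n) × ((Fin n → Bool) → Bool) → ℝ := fun v => pSet A ρ v.1 / (Fintype.card ((Fin n → Bool) → Bool) : ℝ) with hw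
  have hc : (0:ℝ) < (Fintype.card ((Fin n → Bool) → Bool) : ℝ) := by
    exact_mod_cast Fintype.card_pos
  have hw0 : ∀ v, 0 ≤ w v := fun v => div_nonneg (pSet_nonneg _ _ h0 h1 _) hc.le
  have hw1 : ∑ v, w v = 1 := by
    rw [Fintype.sum_prod_type]
    simp only [hw, Finset.sum_const, Finset.card_univ, nsmul_eq_mul]
    rw [← sum_pSet A ρ]
    refine Finset.sum_congr rfl fun S _ => ?_
    field_simp
  have hch := chernoff_lower w hw0 hw1 P X hX0 hX1 hinv μ (by
    intro i hi ω
    refine (hμ i hi ω).trans (le_of_eq ?_)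
    rw [Fintype.sum_prod_type]
    refine Finset.sum_congr rfl fun S _ => ?_
    rw [Finset.sum_div, Finset.mul_sum]
    refine Finset.sum_congr rfl fun z _ => ?_
    simp only [hw]
    ring) l a hl0 hl1
  have htot : ∑ ω : (Fin n → Bool) → Finset (Fin n) × ((Fin n → Bool) → Bool), ∏ i, w (ω i) = 1 := by
    have e2 := Finset.prod_univ_sum (fun _ : (Fin n → Bool) => (Finset.univ : Finset (Finset (Fin n) × ((Fin n → Bool) → Bool))))
      (fun _ a => w a)
    rw [Fintype.piFinset_univ] at e2
    rw [← e2]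
    simp [hw1]
  rw [prSH_eq]
  have : ∑ ω : (Fin n → Bool) → Finset (Fin n) × ((Fin n → Bool) → Bool), ((∏ i, w (ω i)) -
      (if ∑ i ∈ P, X i ω (ω i) < a then 1 else 0) * (∏ i, w (ω i))) ≤
      ∑ ω : (Fin n → Bool) → Finset (Fin n) × ((Fin n → Bool) → Bool),
      (if E (buildF M (fun y => (ω y).1) (fun y => (ω y).2)) then 1 else 0) * ∏ y, w (ω y) := by
    refine Finset.sum_le_sum fun ω _ => ?_
    have hp : 0 ≤ ∏ i, w (ω i) := Finset.prod_nonneg fun i _ => hw0 _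
    by_cases h : ∑ i ∈ P, X i ω (ω i) < a
    · rw [if_pos h]
      split_ifs <;> linarith
    · rw [if_neg h, if_pos (hE ω (not_lt.1 h))]
      linarith
  rw [Finset.sum_sub_distrib, htot] at this
  linarith

lemma sum_half {T B : Type*} [Fintype B] [DecidableEq B] (D : Finset T)
    (b : T → B) (c : T → (B → Bool) → Bool)
    (hc : ∀ x ∈ D, ∀ z v, c x (Function.update z (b x) v) = c x z) :
    (∑ z : B → Bool, ((D.filter fun x => z (b x) ≠ c x z).card : ℝ))
      / (Fintype.card (B → Bool) : ℝ) = D.card / 2 := by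
  have h0 : (0:ℝ) < (Fintype.card (B → Bool) : ℝ) := by exact_mod_cast Fintype.card_pos
  rw [div_eq_iff h0.ne']
  have h1 : ∀ z : B → Bool, ((D.filter fun x => z (b x) ≠ c x z).card : ℝ)
      = ∑ x ∈ D, if z (b x) ≠ c x z then (1:ℝ) else 0 := by
    intro z; rw [Finset.card_filter]; push_cast; rfl
  simp only [h1]
  rw [Finset.sum_comm]
  have h2 : ∀ x ∈ D, ∑ z : B → Bool, (if z (b x) ≠ c x z then (1:ℝ) else 0)
      = (Fintype.card (B → Bool) : ℝ) / 2 := by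
    intro x hx
    have h3 := card_half (b x) (c x) (hc x hx)
    rw [Finset.card_filter] at h3
    have h4 : (2:ℝ) * ∑ z : B → Bool, (if z (b x) ≠ c x z then (1:ℝ) else 0)
        = (Fintype.card (B → Bool) : ℝ) := by
      exact_mod_cast h3
    linarith
  rw [Finset.sum_congr rfl h2]
  simp
  ring

lemma flipAt_flipAt {n : ℕ} (x : Fin n → Bool) (l : Fin n) : flipAt (flipAt x l) l = x := by
  simp [flipAt]

lemma flipAt_self {n : ℕ} (x : Fin n → Bool) (l : Fin n) : flipAt x l l = !x l := by
  simp [flipAt]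

lemma padTo_flip_notMem {n : ℕ} (M : Finset (Fin n)) (x : Fin n → Bool) (l : Fin n) (h : l ∉ M) :
    padTo M (flipAt x l) = padTo M x := by
  ext j
  by_cases hj : j ∈ M
  · have : j ≠ l := by rintro rfl; exact h hj
    simp [padTo, hj, flipAt, this]
  · simp [padTo, hj]

lemma padTo_flip_mem {n : ℕ} (M : Finset (Fin n)) (x : Fin n → Bool) (l : Fin n) (h : l ∈ M) :
    padTo M (flipAt x l) = flipAt (padTo M x) l := by
  ext j
  by_cases hj : j = l
  · subst hj; simp [padTo, h, flipAt]
  · simp [padTo, flipAt, hj]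

lemma padTo_idem {n : ℕ} (M : Finset (Fin n)) (x : Fin n → Bool) :
    padTo M (padTo M x) = padTo M x := by
  ext j; simp only [padTo]; split_ifs <;> rfl

lemma exists_matching {n : ℕ} (f : (Fin n → Bool) → Bool) (V : Finset (Fin n))
    (L : (Fin n → Bool) → Fin n) (hL : ∀ x, L (flipAt x (L x)) = L x)
    (D : Finset (Fin n → Bool))
    (hD : ∀ x ∈ D, L x ∈ V ∧ x (L x) = false ∧ f x ≠ f (flipAt x (L x))) :
    ∃ C, DisjointBichromatic f V C ∧ C.card = D.card := by
  classical
  refine ⟨D.image fun x => (x, L x), ⟨?_, ?_⟩, ?_⟩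
  · intro e he
    obtain ⟨x, hx, rfl⟩ := Finset.mem_image.1 he
    exact ⟨(hD x hx).1, (hD x hx).2.2⟩
  · have key : ∀ x ∈ D, ∀ x' ∈ D, x ≠ flipAt x' (L x') := by
      intro x hx x' hx' h
      have h1 : L x = L x' := by rw [h, hL]
      have h2 := (hD x hx).2.1
      have h3 := (hD x' hx').2.1
      rw [h1, h, flipAt_self, h3] at h2
      simp at h2
    intro e he e' he' hne
    obtain ⟨x, hx, rfl⟩ := Finset.mem_image.1 he
    obtain ⟨x', hx', rfl⟩ := Finset.mem_image.1 he'
    have hxx : x ≠ x' := by rintro rfl; exact hne rfl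
    refine ⟨hxx, key x hx x' hx', (key x' hx' x hx).symm, ?_⟩
    intro h
    dsimp only at h
    have h1 : L x = L x' := by rw [← hL x, h, hL]
    rw [h1] at h
    apply hxx
    rw [← flipAt_flipAt x (L x'), h, flipAt_flipAt]
  · apply Finset.card_image_of_injective
    intro x y h
    exact (Prod.ext_iff.1 h).1

lemma sum_fiber_le {n : ℕ} (M : Finset (Fin n)) (P D : Finset (Fin n → Bool))
    (F : (Fin n → Bool) → Finset (Fin n → Bool))
    (hF : ∀ y ∈ P, ∀ x ∈ F y, padTo M x = y ∧ x ∈ D) :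
    ∑ y ∈ P, (F y).card ≤ D.card := by
  classical
  rw [← Finset.card_biUnion]
  · apply Finset.card_le_card
    intro x hx
    obtain ⟨y, hy, hxy⟩ := Finset.mem_biUnion.1 hx
    exact (hF y hy x hxy).2
  · intro y hy y' hy' hne
    change Disjoint (F y) (F y')
    rw [Finset.disjoint_left]
    intro x hx hx'
    exact hne ((hF y hy x hx).1.symm.trans (hF y' hy' x hx').1)

lemma two_pow_split {n t : ℕ} (ht : t ≤ n) : (2:ℝ) ^ n = 2 ^ t * 2 ^ (n - t) := by
  rw [← pow_add]; congr 1; omega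

lemma caseM (n : ℕ) (M A V : Finset (Fin n)) (ρ ε : ℝ) (h0 : 0 ≤ ρ) (h1 : ρ ≤ 1)
    (hε : ε ≤ 1 / 6) (l : Fin n) (hlM : l ∈ M) (hlV : l ∈ V) :
    1 - Real.exp (-(1 / 100) * 2 ^ M.card) ≤
      prSH n M A ρ (fun f => ∃ C, DisjointBichromatic f V C ∧ ε * 2 ^ n ≤ (C.card : ℝ)) := by
  classical
  have hMn : M.card ≤ n := by simpa using Finset.card_le_univ M
  have hM1 : 1 ≤ M.card := Finset.card_pos.2 ⟨l, hlM⟩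
  set K : ℝ := 2 ^ (n - M.card) with hK
  have hK0 : 0 < K := by positivity
  set P : Finset (Fin n → Bool) :=
    Finset.univ.filter fun y => padTo M y = y ∧ y l = false with hP
  have hPc : (P.card : ℝ) = 2 ^ M.card / 2 := by
    have e : P = Finset.univ.filter fun y => padTo (insert l Mᶜ) y = fun _ => false := by
      ext y
      simp only [hP, Finset.mem_filter, Finset.mem_univ, true_and]
      constructor
      · rintro ⟨ha, hb⟩
        ext j
        simp only [padTo, Finset.mem_insert, Finset.mem_compl]
        split_ifs with hj
        · rcases hj with rfl | hj
          · exact hb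
          · rw [← ha]; simp [padTo, hj]
        · rfl
      · intro h
        constructor
        · ext j
          have := congrFun h j
          simp only [padTo, Finset.mem_insert, Finset.mem_compl] at this ⊢
          split_ifs with hj
          · rfl
          · simp [hj] at this
            exact this.symm
        · have := congrFun h l
          simpa [padTo] using this
    rw [e, card_block]
    · rw [Finset.card_insert_of_notMem (by simpa using hlM), Finset.card_compl, Fintype.card_fin]
      have : n - (n - M.card + 1) = M.card - 1 := by omega
      rw [this]
      push_cast
      rw [eq_div_iff (by norm_num), ← pow_succ]
      congr 1; omega
    · ext j; simp [padTo]
  set F : (Fin n → Bool) → ((Fin n → Bool) → Finset (Fin n) × ((Fin n → Bool) → Bool)) →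
      Finset (Fin n) × ((Fin n → Bool) → Bool) → Finset (Fin n → Bool) := fun y ω v =>
    (Finset.univ.filter fun x => padTo M x = y).filter fun x => v.2 (padTo v.1 x) ≠
      (ω (flipAt y l)).2 (padTo (ω (flipAt y l)).1 (flipAt x l)) with hF
  have hblock : ∀ y ∈ P, ((Finset.univ.filter fun x => padTo M x = y).card : ℝ) = K := by
    intro y hy
    rw [card_block M y (Finset.mem_filter.1 hy).2.1]
    push_cast; rfl
  have main := prSH_ge n M A ρ h0 h1
    (fun f => ∃ C, DisjointBichromatic f V C ∧ ε * 2 ^ n ≤ (C.card : ℝ)) P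
    (fun y ω v => ((F y ω v).card : ℝ) / K) (fun y ω v => by positivity)
    (by
      intro y hy ω v
      rw [div_le_one hK0, ← hblock y hy]
      exact_mod_cast Finset.card_le_card (Finset.filter_subset _ _))
    (by
      intro y hy ω ω' h v
      have : flipAt y l ∉ P := by
        intro h'
        have ha := (Finset.mem_filter.1 h').2.2
        have hb := (Finset.mem_filter.1 hy).2.2
        rw [flipAt_self, hb] at ha
        simp at ha
      simp only [hF, h _ this])
    (1 / 2)
    (by
      intro y hy ω
      apply le_of_eq
      have : ∀ S, (∑ z, ((F y ω (S, z)).card : ℝ) / K) /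
          (Fintype.card ((Fin n → Bool) → Bool) : ℝ) = 1 / 2 := by
        intro S
        rw [← Finset.sum_div, div_right_comm]
        simp only [hF]
        rw [sum_half (Finset.univ.filter fun x => padTo M x = y) (fun x => padTo S x)
          (fun x _ => (ω (flipAt y l)).2 (padTo (ω (flipAt y l)).1 (flipAt x l)))
          (fun _ _ _ _ => rfl), hblock y hy]
        field_simp
      simp only [this]
      rw [← Finset.sum_mul, sum_pSet, one_mul])
    (1 / 2) (2 ^ M.card / 6) (by norm_num) (by norm_num)
    (by
      intro ω hsum
      set f := buildF M (fun y => (ω y).1) (fun y => (ω y).2) with hf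
      set D : Finset (Fin n → Bool) :=
        Finset.univ.filter fun x => x l = false ∧ f x ≠ f (flipAt x l) with hD
      obtain ⟨C, hC, hCD⟩ := exists_matching f V (fun _ => l) (fun _ => rfl) D (by
        intro x hx
        exact ⟨hlV, (Finset.mem_filter.1 hx).2⟩)
      refine ⟨C, hC, ?_⟩
      have hle := sum_fiber_le M P D (fun y => F y ω (ω y)) (by
        intro y hy x hx
        have hx1 := Finset.mem_filter.1 hx
        have hx2 := (Finset.mem_filter.1 hx1.1).2
        refine ⟨hx2, ?_⟩
        have hy2 := (Finset.mem_filter.1 hy).2.2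
        refine Finset.mem_filter.2 ⟨Finset.mem_univ _, ?_, ?_⟩
        · rw [← hx2] at hy2
          simpa [padTo, hlM] using hy2
        · have := hx1.2
          simp only [hf, buildF, padTo_flip_mem M x l hlM, hx2]
          exact this)
      have hle' : (∑ y ∈ P, ((F y ω (ω y)).card : ℝ)) ≤ D.card := by exact_mod_cast hle
      rw [← Finset.sum_div, le_div_iff₀ hK0] at hsum
      rw [hCD, two_pow_split hMn]
      have : (0:ℝ) < 2 ^ M.card * K := by positivity
      calc ε * (2 ^ M.card * K) ≤ 1 / 6 * (2 ^ M.card * K) := by gcongr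
        _ = 2 ^ M.card / 6 * K := by ring
        _ ≤ D.card := hsum.trans hle')
  refine le_trans ?_ main
  rw [hPc]
  have : (0:ℝ) < 2 ^ M.card := by positivity
  apply sub_le_sub_left
  apply Real.exp_le_exp.2
  nlinarith

lemma caseA (n : ℕ) (M A V : Finset (Fin n)) (ρ ε : ℝ) (h0 : 0 ≤ ρ) (h1 : ρ ≤ 1)
    (hVA : V ⊆ A) (hVM : ∀ l ∈ V, l ∉ M) (l0 : Fin n) (hl0 : l0 ∈ V) :
    1 - Real.exp ((1 / 5) * (ε * 2 ^ M.card) -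
        9 / 50 * ((1 - (1 - ρ) ^ V.card) / 4) * 2 ^ M.card) ≤
      prSH n M A ρ (fun f => ∃ C, DisjointBichromatic f V C ∧ ε * 2 ^ n ≤ (C.card : ℝ)) := by
  classical
  have hMn : M.card ≤ n := by simpa using Finset.card_le_univ M
  have hMn1 : M.card + 1 ≤ n := by
    have := Finset.card_le_univ (insert l0 M)
    rw [Finset.card_insert_of_notMem (hVM l0 hl0)] at this
    simpa using this
  set K : ℝ := 2 ^ (n - M.card) with hK
  have hK0 : 0 < K := by positivity
  set dir : Finset (Fin n) → Fin n :=
    fun T => if h : (T ∩ V).Nonempty then h.choose else l0 with hdir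
  have hdirV : ∀ T, dir T ∈ V := by
    intro T
    by_cases h : (T ∩ V).Nonempty
    · simp only [hdir, dif_pos h]
      exact (Finset.mem_inter.1 h.choose_spec).2
    · simp only [hdir, dif_neg h]; exact hl0
  have hdirT : ∀ T, (T ∩ V).Nonempty → dir T ∈ T := by
    intro T h
    simp only [hdir, dif_pos h]
    exact (Finset.mem_inter.1 h.choose_spec).1
  set P : Finset (Fin n → Bool) := Finset.univ.filter fun y => padTo M y = y with hP
  have hPc : (P.card : ℝ) = 2 ^ M.card := by
    have e : P = Finset.univ.filter fun y => padTo Mᶜ y = fun _ => false := by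
      ext y
      simp only [hP, Finset.mem_filter, Finset.mem_univ, true_and, funext_iff, padTo,
        Finset.mem_compl]
      refine forall_congr' fun j => ?_
      by_cases hj : j ∈ M
      · simp [hj]
      · simp only [hj, if_false, not_false_eq_true, if_true]
        exact eq_comm
    rw [e, card_block]
    · rw [Finset.card_compl, Fintype.card_fin]
      have : n - (n - M.card) = M.card := by omega
      rw [this]
      push_cast; rfl
    · ext j; simp [padTo]
  set F : (Fin n → Bool) → Finset (Fin n) × ((Fin n → Bool) → Bool) →
      Finset (Fin n → Bool) := fun y v =>
    (Finset.univ.filter fun x => padTo (insert (dir v.1) M) x = y).filter fun x =>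
      v.2 (padTo v.1 x) ≠ v.2 (padTo v.1 (flipAt x (dir v.1))) with hF
  have hylF : ∀ y ∈ P, ∀ l ∈ V, y l = false := by
    intro y hy l hl
    rw [← (Finset.mem_filter.1 hy).2]
    simp [padTo, hVM l hl]
  have hblock : ∀ y ∈ P, ∀ T,
      ((Finset.univ.filter fun x => padTo (insert (dir T) M) x = y).card : ℝ) = K / 2 := by
    intro y hy T
    rw [card_block]
    · rw [Finset.card_insert_of_notMem (hVM _ (hdirV T))]
      push_cast
      rw [eq_div_iff (by norm_num), ← pow_succ, hK]
      congr 1; omega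
    · ext j
      simp only [padTo]
      split_ifs with hj
      · rfl
      · rw [← (Finset.mem_filter.1 hy).2]
        have : j ∉ M := fun h => hj (Finset.mem_insert_of_mem h)
        simp [padTo, this]
  have main := prSH_ge n M A ρ h0 h1
    (fun f => ∃ C, DisjointBichromatic f V C ∧ ε * 2 ^ n ≤ (C.card : ℝ)) P
    (fun y _ v => if (v.1 ∩ V).Nonempty then ((F y v).card : ℝ) / K else 0)
    (fun y ω v => by split_ifs <;> positivity)
    (by
      intro y hy ω v
      split_ifs
      · rw [div_le_one hK0]
        have e1 : ((F y v).card : ℝ) ≤ K / 2 := by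
          rw [← hblock y hy v.1]
          exact_mod_cast Finset.card_le_card (Finset.filter_subset _ _)
        linarith
      · norm_num)
    (fun y hy ω ω' h v => rfl)
    ((1 - (1 - ρ) ^ V.card) / 4)
    (by
      intro y hy ω
      apply le_of_eq
      have : ∀ S, pSet A ρ S * ((∑ z, if (S ∩ V).Nonempty then ((F y (S, z)).card : ℝ) / K else 0) /
          (Fintype.card ((Fin n → Bool) → Bool) : ℝ))
          = (if (S ∩ V).Nonempty then pSet A ρ S else 0) / 4 := by
        intro S
        split_ifs with hS
        · rw [← Finset.sum_div, div_right_comm]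
          simp only [hF]
          rw [sum_half (Finset.univ.filter fun x => padTo (insert (dir S) M) x = y)
            (fun x => padTo S x)
            (fun x z => z (padTo S (flipAt x (dir S)))), hblock y hy]
          · field_simp; norm_num
          · intro x _ z v
            apply Function.update_of_ne
            intro h
            have := congrFun h (dir S)
            simp [padTo, hdirT S hS, flipAt] at this
        · simp
      simp only [this]
      rw [← Finset.sum_div, sum_pSet_disj A V hVA])
    (1 / 5) (ε * 2 ^ M.card) (by norm_num) (by norm_num)
    (by
      intro ω hsum
      set f := buildF M (fun y => (ω y).1) (fun y => (ω y).2) with hf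
      set L : (Fin n → Bool) → Fin n := fun x => dir (ω (padTo M x)).1 with hL
      set D : Finset (Fin n → Bool) :=
        Finset.univ.filter fun x => x (L x) = false ∧ f x ≠ f (flipAt x (L x)) with hD
      obtain ⟨C, hC, hCD⟩ := exists_matching f V L
        (by
          intro x
          have := padTo_flip_notMem M x (L x) (hVM _ (hdirV _))
          simp only [hL] at this ⊢
          rw [this]) D (by
        intro x hx
        exact ⟨hdirV _, (Finset.mem_filter.1 hx).2⟩)
      refine ⟨C, hC, ?_⟩
      have hle := sum_fiber_le M P D
        (fun y => if ((ω y).1 ∩ V).Nonempty then F y (ω y) else ∅) (by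
        intro y hy x hx
        by_cases hne : ((ω y).1 ∩ V).Nonempty
        swap
        · rw [if_neg hne] at hx; simp at hx
        rw [if_pos hne] at hx
        have hx1 := Finset.mem_filter.1 hx
        have hx2 := (Finset.mem_filter.1 hx1.1).2
        have hx3 : padTo M x = y := by
          ext j
          have hj := congrFun hx2 j
          by_cases hjM : j ∈ M
          · simp [padTo, hjM] at hj ⊢; exact hj
          · rw [← (Finset.mem_filter.1 hy).2]; simp [padTo, hjM]
        refine ⟨hx3, ?_⟩
        refine Finset.mem_filter.2 ⟨Finset.mem_univ _, ?_, ?_⟩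
        · have hj := congrFun hx2 (dir (ω y).1)
          rw [hylF y hy _ (hdirV _)] at hj
          simp only [hL, hx3]
          simpa [padTo] using hj
        · have := hx1.2
          simp only [hf, buildF, padTo_flip_notMem M x (L x) (hVM _ (hdirV _))]
          simp only [hL, hx3]
          exact this)
      have hle' : (∑ y ∈ P, (if ((ω y).1 ∩ V).Nonempty then ((F y (ω y)).card : ℝ) / K else 0))
          ≤ D.card / K := by
        rw [le_div_iff₀ hK0, Finset.sum_mul]
        refine le_trans (le_of_eq ?_) (Nat.cast_le.2 hle)
        push_cast
        refine Finset.sum_congr rfl fun y _ => ?_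
        split_ifs
        · field_simp
        · simp
      have := hsum.trans hle'
      rw [le_div_iff₀ hK0] at this
      rw [hCD, two_pow_split hMn, ← mul_assoc]
      exact this)
  refine le_trans (le_of_eq ?_) main
  rw [hPc]
  norm_num

lemma growth (β k : ℝ) (hβ : 0 < β) :
    ∃ n₀ : ℕ, 1 ≤ n₀ ∧ ∀ n : ℕ, n₀ ≤ n →
      k * Real.sqrt n * Real.logb 2 n + 10 ≤ β * n := by
  have hl2 : 0 < Real.log 2 := Real.log_pos (by norm_num)
  set q : ℝ := β / 2 * Real.log 2 / (|k| + 1) with hq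
  have hk : 0 < |k| + 1 := by positivity
  have hq0 : 0 < q := by positivity
  have h1 := (isLittleO_log_rpow_atTop (r := 1 / 2) (by norm_num)).bound hq0
  have h2 := (tendsto_natCast_atTop_atTop (R := ℝ)).eventually h1
  have h3 := (tendsto_natCast_atTop_atTop (R := ℝ)).eventually (Filter.eventually_ge_atTop (20 / β))
  obtain ⟨N, hN⟩ := Filter.eventually_atTop.1 (h2.and h3)
  refine ⟨max N 1, le_max_right _ _, fun n hn => ?_⟩
  obtain ⟨ha, hb⟩ := hN n ((le_max_left _ _).trans hn)
  have hn1 : (1:ℝ) ≤ n := by exact_mod_cast (le_max_right _ _).trans hn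
  rw [← Real.sqrt_eq_rpow, Real.norm_of_nonneg (Real.log_nonneg hn1),
    Real.norm_of_nonneg (Real.sqrt_nonneg _)] at ha
  have hs : Real.sqrt n * Real.sqrt n = n := Real.mul_self_sqrt (by linarith)
  have hs0 := Real.sqrt_nonneg (n:ℝ)
  have hlog : Real.logb 2 n ≤ β / 2 / (|k| + 1) * Real.sqrt n := by
    rw [Real.logb, div_le_iff₀ hl2]
    refine ha.trans (le_of_eq ?_)
    rw [hq]; ring
  have hlog0 : 0 ≤ Real.logb 2 n := Real.logb_nonneg (by norm_num) hn1
  have hA : k * Real.sqrt n * Real.logb 2 n ≤ β / 2 * n := by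
    calc k * Real.sqrt n * Real.logb 2 n ≤ (|k| + 1) * Real.sqrt n * Real.logb 2 n := by
          gcongr; linarith [le_abs_self k]
      _ ≤ (|k| + 1) * Real.sqrt n * (β / 2 / (|k| + 1) * Real.sqrt n) := by gcongr
      _ = β / 2 * (Real.sqrt n * Real.sqrt n) := by field_simp
      _ = β / 2 * n := by rw [hs]
  have hB : 20 ≤ β * n := by
    rw [div_le_iff₀ hβ] at hb; linarith
  linarith

lemma exp_conv (ε : ℝ) (h0 : 0 ≤ ε) (h1 : ε ≤ 1 / 6) : Real.exp (-(9 * ε)) ≤ 1 - 23 / 5 * ε := by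
  have h := convexOn_exp.2 (Set.mem_univ (0:ℝ)) (Set.mem_univ (-(3 / 2) : ℝ))
      (show 0 ≤ 1 - 6 * ε by linarith) (show 0 ≤ 6 * ε by linarith) (by ring)
  simp only [smul_eq_mul, mul_zero, zero_add, Real.exp_zero, mul_one] at h
  have e : 6 * ε * -(3 / 2) = -(9 * ε) := by ring
  rw [e] at h
  have h2 : Real.exp (-(3 / 2)) ≤ 7 / 30 := by
    have h3 : Real.exp (3 / 2) ^ 2 = Real.exp 1 ^ 3 := by
      rw [← Real.exp_nat_mul, ← Real.exp_nat_mul]; norm_num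
    have h4 : (2.7 : ℝ) ^ 3 ≤ Real.exp 1 ^ 3 := by
      have := Real.exp_one_gt_d9
      gcongr; linarith
    have h5 : (30 / 7 : ℝ) ≤ Real.exp (3 / 2) := by
      refine (pow_le_pow_iff_left₀ (by norm_num) (Real.exp_pos _).le two_ne_zero).1 ?_
      rw [h3]; refine le_trans ?_ h4; norm_num
    rw [Real.exp_neg]
    have := inv_anti₀ (by norm_num) h5
    linarith
  nlinarith

theorem stmt4 (α : ℝ) (hα₁ : 1 / 2 < α) (hα₂ : α < 1) :
    ∃ (c : ℝ) (n₀ : ℕ), 0 < c ∧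
      ∀ (n : ℕ) (ε : ℝ) (M A V : Finset (Fin n)),
        n₀ ≤ n →
        (2 : ℝ) ^ (-((2 * α - 1) * (n : ℝ) / 2)) ≤ ε → ε ≤ 1 / 6 →
        ∀ m t : ℕ,
          m = ⌈2 * (1 - α) * (n : ℝ) + (1 - α) * Real.sqrt n * Real.logb 2 n⌉₊ →
          t = n - m →
          M.card = t → A ⊆ Mᶜ →
          (1 - α) * (n : ℝ) + 2 * (1 - α) * Real.sqrt n * Real.logb 2 n ≤ (A.card : ℝ) →
          V ⊆ M ∪ A → V.card = ⌈9 * Real.sqrt n⌉₊ →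
          1 - Real.exp (-(2 : ℝ) ^ (c * n)) ≤
            prSH n M A (ε / Real.sqrt n)
              (fun f => ∃ C, DisjointBichromatic f V C ∧ ε * 2 ^ n ≤ (C.card : ℝ)) := by
  have hβ : 0 < (2 * α - 1) / 4 := by linarith
  obtain ⟨n₀, hn₀, hgrow⟩ := growth ((2 * α - 1) / 4) (1 - α) hβ
  refine ⟨(2 * α - 1) / 4, n₀, hβ, ?_⟩
  intro n ε M A V hn hε1 hε2 m t hm ht hMt _ _ hVMA hVc
  have hg := hgrow n hn
  have hn1 : (1:ℝ) ≤ n := by exact_mod_cast hn₀.trans hn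
  have hs1 : 1 ≤ Real.sqrt n := by rw [Real.one_le_sqrt]; exact hn1
  have hs0 : 0 < Real.sqrt n := by linarith
  have hlog0 : 0 ≤ Real.logb 2 n := Real.logb_nonneg (by norm_num) hn1
  have hε0 : 0 < ε := lt_of_lt_of_le (by positivity) hε1
  have hρ0 : 0 ≤ ε / Real.sqrt n := by positivity
  have hρ1 : ε / Real.sqrt n ≤ 1 := by rw [div_le_one hs0]; linarith
  have hT0 : (0:ℝ) < 2 ^ M.card := by positivity
  have hmle : (m:ℝ) ≤ 2 * (1 - α) * (n : ℝ) + (1 - α) * Real.sqrt n * Real.logb 2 n + 1 := by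
    rw [hm]
    apply (Nat.ceil_lt_add_one _).le
    have : 0 ≤ 1 - α := by linarith
    positivity
  have htge : (n:ℝ) - m ≤ t := by
    rw [ht]
    have : n ≤ (n - m) + m := by omega
    have : (n:ℝ) ≤ ((n - m : ℕ) : ℝ) + m := by exact_mod_cast this
    linarith
  have hbig : (2:ℝ) ^ ((2 * α - 1) / 4 * (n:ℝ)) ≤ 1 / 200 * (ε * 2 ^ M.card) := by
    have e1 : (2:ℝ) ^ ((2 * α - 1) / 4 * (n:ℝ) + (9:ℝ)) ≤ ε * 2 ^ M.card := by
      calc (2:ℝ) ^ ((2 * α - 1) / 4 * (n:ℝ) + (9:ℝ))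
          ≤ (2:ℝ) ^ (-((2 * α - 1) * (n : ℝ) / 2) + (t:ℝ)) := by
            apply Real.rpow_le_rpow_of_exponent_le (by norm_num)
            linarith
        _ = (2:ℝ) ^ (-((2 * α - 1) * (n : ℝ) / 2)) * 2 ^ M.card := by
            rw [Real.rpow_add (by norm_num), Real.rpow_natCast, hMt]
        _ ≤ _ := by gcongr
    rw [Real.rpow_add (by norm_num)] at e1
    have e2 : (2:ℝ) ^ (9:ℝ) = 512 := by
      rw [show (9:ℝ) = ((9:ℕ):ℝ) by norm_num, Real.rpow_natCast]; norm_num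
    rw [e2] at e1
    have : (0:ℝ) < (2:ℝ) ^ ((2 * α - 1) / 4 * (n:ℝ)) := by positivity
    linarith
  have hVge : 9 * Real.sqrt n ≤ V.card := by rw [hVc]; exact Nat.le_ceil _
  by_cases hVM : ∃ l ∈ V, l ∈ M
  · obtain ⟨l, hlV, hlM⟩ := hVM
    refine le_trans ?_ (caseM n M A V _ ε hρ0 hρ1 hε2 l hlM hlV)
    apply sub_le_sub_left
    apply Real.exp_le_exp.2
    nlinarith
  · push Not at hVM
    have hVA : V ⊆ A := by
      intro l hl
      rcases Finset.mem_union.1 (hVMA hl) with h | h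
      · exact absurd h (hVM l hl)
      · exact h
    have hVpos : 0 < V.card := by
      have : (0:ℝ) < V.card := by linarith
      exact_mod_cast this
    obtain ⟨l0, hl0⟩ := Finset.card_pos.1 hVpos
    refine le_trans ?_ (caseA n M A V _ ε hρ0 hρ1 hVA hVM l0 hl0)
    have hq : (1 - ε / Real.sqrt n) ^ V.card ≤ 1 - 23 / 5 * ε := by
      refine le_trans ?_ (exp_conv ε hε0.le hε2)
      calc (1 - ε / Real.sqrt n) ^ V.card ≤ Real.exp (-(ε / Real.sqrt n)) ^ V.card := by
            apply pow_le_pow_left₀ (by linarith)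
            have := Real.add_one_le_exp (-(ε / Real.sqrt n))
            linarith
        _ = Real.exp (-(ε / Real.sqrt n * V.card)) := by
            rw [← Real.exp_nat_mul]; congr 1; ring
        _ ≤ Real.exp (-(9 * ε)) := by
            apply Real.exp_le_exp.2
            have := mul_le_mul_of_nonneg_left hVge hρ0
            have e : ε / Real.sqrt n * (9 * Real.sqrt n) = 9 * ε := by field_simp
            linarith
    apply sub_le_sub_left
    apply Real.exp_le_exp.2
    have hq2 := mul_le_mul_of_nonneg_right hq hT0.le
    have : 0 < ε * 2 ^ M.card := by positivity
    nlinarith
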